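/- For all Boolean normal monotonic (BNM) schemes 𝕏 and 𝕏', the dual transitive closure of the intersection of the ss-valid and tt-valid inferences is empty: T^d(SS(𝕏) ∩ TT(𝕏')) = ∅ (and hence equals TS(𝕏'') for any BNM scheme 𝕏''). -/

import Mathlib

namespace ThreeValued

/-- Formulas of the propositional language: countably many variables,
negation, conjunction, disjunction. -/
inductive Fml : Type
  | var : ℕ → Fml
  | neg : Fml → Fml
  | conj : Fml → Fml → Fml
  | disj : Fml → Fml → Fml
deriving DecidableEq

/-- An inference Γ ⇒ φ: a finite set of premises and a conclusion. -/
structure Infer : Type where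
  prem : Finset Fml
  concl : Fml

/-- A set of inferences is closed under transitivity:
whenever there is a nonempty Δ with Δ ⇒ φ ∈ L and Γ ⇒ δ ∈ L for all δ ∈ Δ,
then Γ ⇒ φ ∈ L. -/
def TransClosed (L : Set Infer) : Prop :=
  ∀ (Γ Δ : Finset Fml) (φ : Fml), Δ.Nonempty →
    (⟨Δ, φ⟩ : Infer) ∈ L → (∀ δ ∈ Δ, (⟨Γ, δ⟩ : Infer) ∈ L) → (⟨Γ, φ⟩ : Infer) ∈ L

/-- The transitive closure of a set of inferences: the least superset closed
under transitivity. -/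
def T (L : Set Infer) : Set Infer := ⋂₀ {L' : Set Infer | L ⊆ L' ∧ TransClosed L'}

/-- A set of inferences is open under dual transitivity:
whenever there is a nonempty Δ with Δ ⇒ φ ∉ L and Γ ⇒ δ ∉ L for all δ ∈ Δ,
then Γ ⇒ φ ∉ L. -/
def DualTransClosed (L : Set Infer) : Prop :=
  ∀ (Γ Δ : Finset Fml) (φ : Fml), Δ.Nonempty →
    (⟨Δ, φ⟩ : Infer) ∉ L → (∀ δ ∈ Δ, (⟨Γ, δ⟩ : Infer) ∉ L) → (⟨Γ, φ⟩ : Infer) ∉ L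

/-- The dual transitive closure: the greatest subset open under dual
transitivity. -/
def Td (L : Set Infer) : Set Infer := ⋃₀ {L' : Set Infer | L' ⊆ L ∧ DualTransClosed L'}

/-- The three truth values 0, 1/2, 1. -/
inductive V3 : Type
  | zero | half | one
deriving DecidableEq

/-- A three-valued scheme: a triple of truth functions for ¬, ∧ and ∨. -/
structure Scheme : Type where
  fneg : V3 → V3
  fconj : V3 → V3 → V3
  fdisj : V3 → V3 → V3

/-- Boolean normality: on Boolean inputs the operations agree with the
classical ones. -/
def BooleanNormal (X : Scheme) : Prop :=
  X.fneg .zero = .one ∧ X.fneg .one = .zero ∧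
  X.fconj .one .one = .one ∧ X.fconj .one .zero = .zero ∧
  X.fconj .zero .one = .zero ∧ X.fconj .zero .zero = .zero ∧
  X.fdisj .one .one = .one ∧ X.fdisj .one .zero = .one ∧
  X.fdisj .zero .one = .one ∧ X.fdisj .zero .zero = .zero

/-- The information order: 1/2 is below 0 and below 1. -/
def infLe (a b : V3) : Prop := a = .half ∨ a = b

/-- Monotonicity of a scheme with respect to the information order. -/
def Monotonic (X : Scheme) : Prop :=
  (∀ a b, infLe a b → infLe (X.fneg a) (X.fneg b)) ∧
  (∀ a₁ a₂ b₁ b₂, infLe a₁ b₁ → infLe a₂ b₂ → infLe (X.fconj a₁ a₂) (X.fconj b₁ b₂)) ∧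
  (∀ a₁ a₂ b₁ b₂, infLe a₁ b₁ → infLe a₂ b₂ → infLe (X.fdisj a₁ a₂) (X.fdisj b₁ b₂))

/-- Boolean normal monotonic schemes. -/
def BNM (X : Scheme) : Prop := BooleanNormal X ∧ Monotonic X

/-- Valuations respecting a scheme. -/
def Respects (X : Scheme) (v : Fml → V3) : Prop :=
  (∀ φ, v (.neg φ) = X.fneg (v φ)) ∧
  (∀ φ ψ, v (.conj φ ψ) = X.fconj (v φ) (v ψ)) ∧
  (∀ φ ψ, v (.disj φ ψ) = X.fdisj (v φ) (v ψ))

/-- The strict formula-standard s = {1}. -/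
def sStd : Set V3 := {.one}

/-- The tolerant formula-standard t = {1, 1/2}. -/
def tStd : Set V3 := {.one, .half}

/-- An inference is xy-valid over a scheme X if every valuation respecting X
whose value on each premise is in x gives the conclusion a value in y. -/
def Valid (X : Scheme) (x y : Set V3) (I : Infer) : Prop :=
  ∀ v : Fml → V3, Respects X v → (∀ γ ∈ I.prem, v γ ∈ x) → v I.concl ∈ y

/-- The ss-valid inferences over X. -/
def SS (X : Scheme) : Set Infer := {I | Valid X sStd sStd I}

/-- The tt-valid inferences over X. -/
def TT (X : Scheme) : Set Infer := {I | Valid X tStd tStd I}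

/-- The st-valid inferences over X. -/
def ST (X : Scheme) : Set Infer := {I | Valid X sStd tStd I}

/-- The ts-valid inferences over X. -/
def TS (X : Scheme) : Set Infer := {I | Valid X tStd sStd I}

/-- Classical two-valued valuations. -/
def RespectsCL (v : Fml → Bool) : Prop :=
  (∀ φ, v (.neg φ) = ! v φ) ∧
  (∀ φ ψ, v (.conj φ ψ) = (v φ && v ψ)) ∧
  (∀ φ ψ, v (.disj φ ψ) = (v φ || v ψ))

/-- The classically valid inferences. -/
def CL : Set Infer :=
  {I | ∀ v : Fml → Bool, RespectsCL v → (∀ γ ∈ I.prem, v γ = true) → v I.concl = true}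

/-- Substitution: the homomorphic extension of a map from variables to
formulas. -/
def subst (σ : ℕ → Fml) : Fml → Fml
  | .var n => σ n
  | .neg φ => .neg (subst σ φ)
  | .conj φ ψ => .conj (subst σ φ) (subst σ ψ)
  | .disj φ ψ => .disj (subst σ φ) (subst σ ψ)

/-- Reflexivity. -/
def PropR (L : Set Infer) : Prop := ∀ φ : Fml, (⟨{φ}, φ⟩ : Infer) ∈ L

/-- Monotonicity (weakening). -/
def PropM (L : Set Infer) : Prop :=
  ∀ (Γ Sg : Finset Fml) (φ : Fml), (⟨Γ, φ⟩ : Infer) ∈ L → Γ ⊆ Sg → (⟨Sg, φ⟩ : Infer) ∈ L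

/-- Structurality (closure under substitutions). -/
def PropS (L : Set Infer) : Prop :=
  ∀ (Γ : Finset Fml) (φ : Fml), (⟨Γ, φ⟩ : Infer) ∈ L →
    ∀ σ : ℕ → Fml, (⟨Γ.image (subst σ), subst σ φ⟩ : Infer) ∈ L

/-- The Tarskian closure: the least superset satisfying (R), (M), (T), (S). -/
def Tar (L : Set Infer) : Set Infer :=
  ⋂₀ {L' : Set Infer | L ⊆ L' ∧ PropR L' ∧ PropM L' ∧ TransClosed L' ∧ PropS L'}

/-- L⋆: the inferences whose premise set is an antitheorem of L or whose
conclusion is a theorem of L. -/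
def starL (L : Set Infer) : Set Infer :=
  {I | (∀ ψ : Fml, (⟨I.prem, ψ⟩ : Infer) ∈ L) ∨ (∀ Δ : Finset Fml, (⟨Δ, I.concl⟩ : Infer) ∈ L)}

/-- The propositional variables occurring in a formula. -/
def fvars : Fml → Finset ℕ
  | .var n => {n}
  | .neg φ => fvars φ
  | .conj φ ψ => fvars φ ∪ fvars ψ
  | .disj φ ψ => fvars φ ∪ fvars ψ

/-- The valuation over a scheme extending an assignment to the variables. -/
def Scheme.eval (X : Scheme) (a : ℕ → V3) : Fml → V3
  | .var n => a n
  | .neg φ => X.fneg (X.eval a φ)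
  | .conj φ ψ => X.fconj (X.eval a φ) (X.eval a ψ)
  | .disj φ ψ => X.fdisj (X.eval a φ) (X.eval a ψ)

theorem Scheme.respects_eval (X : Scheme) (a : ℕ → V3) : Respects X (X.eval a) :=
  ⟨fun _ => rfl, fun _ _ => rfl, fun _ _ => rfl⟩

theorem BNM.fneg_half {X : Scheme} (h : BNM X) : X.fneg .half = .half := by
  obtain ⟨hB, hM, -, -⟩ := h
  have h0 := hM .half .zero (.inl rfl)
  have h1 := hM .half .one (.inl rfl)
  simp only [BooleanNormal, infLe] at *
  grind

theorem BNM.fconj_half {X : Scheme} (h : BNM X) : X.fconj .half .half = .half := by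
  obtain ⟨hB, -, hM, -⟩ := h
  have h0 := hM .half .half .zero .zero (.inl rfl) (.inl rfl)
  have h1 := hM .half .half .one .one (.inl rfl) (.inl rfl)
  simp only [BooleanNormal, infLe] at *
  grind

theorem BNM.fdisj_half {X : Scheme} (h : BNM X) : X.fdisj .half .half = .half := by
  obtain ⟨hB, -, -, hM⟩ := h
  have h0 := hM .half .half .zero .zero (.inl rfl) (.inl rfl)
  have h1 := hM .half .half .one .one (.inl rfl) (.inl rfl)
  simp only [BooleanNormal, infLe] at *
  grind

/-- A formula all of whose variables take the value 1/2 takes the value 1/2. -/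
theorem BNM.eval_eq_half {X : Scheme} (h : BNM X) {a : ℕ → V3} {φ : Fml}
    (ha : ∀ n ∈ fvars φ, a n = .half) : X.eval a φ = .half := by
  induction φ with
  | var n => exact ha n (Finset.mem_singleton_self n)
  | neg φ ih => rw [Scheme.eval, ih ha, h.fneg_half]
  | conj φ ψ ihφ ihψ =>
    rw [Scheme.eval, ihφ fun n hn => ha n (Finset.mem_union_left _ hn),
      ihψ fun n hn => ha n (Finset.mem_union_right _ hn), h.fconj_half]
  | disj φ ψ ihφ ihψ =>
    rw [Scheme.eval, ihφ fun n hn => ha n (Finset.mem_union_left _ hn),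
      ihψ fun n hn => ha n (Finset.mem_union_right _ hn), h.fdisj_half]

/-- A formula does not follow strictly from a variable foreign to it. -/
theorem BNM.var_notMem_SS {X : Scheme} (h : BNM X) {p : ℕ} {φ : Fml} (hp : p ∉ fvars φ) :
    (⟨{.var p}, φ⟩ : Infer) ∉ SS X := by
  intro hv
  have hφ : X.eval (Function.update (fun _ => .half) p .one) φ = .half :=
    h.eval_eq_half fun n hn => Function.update_of_ne (ne_of_mem_of_not_mem hn hp) _ _
  have := hv _ (X.respects_eval (Function.update (fun _ => .half) p .one))
    (by simp [Scheme.eval, sStd])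
  simp [hφ, sStd] at this

/-- A variable foreign to the premises does not follow tolerantly from them. -/
theorem BNM.var_notMem_TT {X : Scheme} (h : BNM X) {p : ℕ} {Γ : Finset Fml}
    (hp : ∀ γ ∈ Γ, p ∉ fvars γ) : (⟨Γ, .var p⟩ : Infer) ∉ TT X := by
  intro hv
  have := hv _ (X.respects_eval (Function.update (fun _ => .half) p .zero)) fun γ hγ =>
    .inr (h.eval_eq_half fun n hn =>
      Function.update_of_ne (ne_of_mem_of_not_mem hn (hp γ hγ)) _ _)
  simp [Scheme.eval, tStd] at this

theorem BNM.TS_eq_empty {X : Scheme} (h : BNM X) : TS X = ∅ := by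
  refine Set.eq_empty_of_forall_notMem fun I hI => ?_
  have hhalf (φ : Fml) : X.eval (fun _ => .half) φ = .half := h.eval_eq_half fun _ _ => rfl
  have := hI _ (X.respects_eval fun _ => .half) fun γ _ => .inr (hhalf γ)
  simp [hhalf, sStd] at this

theorem Td_SS_inter_TT_eq_empty {X X' : Scheme} (h : BNM X) (h' : BNM X') :
    Td (SS X ∩ TT X') = ∅ := by
  refine Set.eq_empty_of_forall_notMem ?_
  rintro ⟨Γ, φ⟩ ⟨L, ⟨hL, hdual⟩, hI⟩
  obtain ⟨p, hp⟩ := Infinite.exists_notMem_finset (Γ.biUnion fvars ∪ fvars φ)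
  simp only [Finset.mem_union, Finset.mem_biUnion, not_or, not_exists, not_and] at hp
  refine hdual Γ {.var p} φ (Finset.singleton_nonempty _)
    (fun hm => h.var_notMem_SS hp.2 (hL hm).1) (fun δ hδ hm => ?_) hI
  rw [Finset.mem_singleton.mp hδ] at hm
  exact h'.var_notMem_TT hp.1 (hL hm).2

/-- The dual transitive closure of the intersection of SS and TT is empty,
and hence equals TS over any BNM scheme. -/
theorem stmt9 : ∀ X X' : Scheme, BNM X → BNM X' →
    Td (SS X ∩ TT X') = ∅ ∧
    ∀ X'' : Scheme, BNM X'' → Td (SS X ∩ TT X') = TS X'' := by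
  intro X X' h h'
  have hTd := Td_SS_inter_TT_eq_empty h h'
  exact ⟨hTd, fun X'' h'' => hTd.trans h''.TS_eq_empty.symm⟩

end ThreeValued
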